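/- The 3-state 3-symbol Turing machine M with transition table δ(A,0)=(1,R,B), δ(A,1)=(2,L,A), δ(A,2)=(1,L,C), δ(B,0)=(0,L,A), δ(B,1)=(2,R,B), δ(B,2)=(1,L,B), δ(C,0)=(1,R,H), δ(C,1)=(1,R,A), δ(C,2)=(1,R,C), started in state A on the all-blank tape, halts after exactly 119,112,334,170,342,540 steps leaving exactly 374,676,383 non-blank cells on the tape; consequently S(3,3) ≥ 119,112,334,170,342,540 and Σ(3,3) ≥ 374,676,383. -/

import Mathlib

/-- Move direction of the tape head. -/
inductive Dir : Type
  | L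
  | R

/-- The head displacement of a direction. -/
def Dir.move : Dir → ℤ
  | Dir.L => -1
  | Dir.R => 1

/-- A Turing machine with `n` states and `k` symbols, in Rado's busy beaver model.
States are `Fin n` (state `A` is `0`, `B` is `1`, ...), symbols are `Fin k` with `0`
the blank symbol. A transition yields the written symbol, the move direction and the
next state, where `none` denotes the halting state `H`. -/
abbrev Machine (n k : ℕ) : Type :=
  Fin n → Fin k → Fin k × Dir × Option (Fin n)

/-- A configuration: current state (`none` = halted), head position, tape. -/
structure Cfg (n k : ℕ) where
  state : Option (Fin n)
  pos : ℤ
  tape : ℤ → Fin k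

/-- One computation step (halted configurations are fixed). -/
def step {n k : ℕ} (M : Machine n k) (c : Cfg n k) : Cfg n k :=
  match c.state with
  | none => c
  | some q =>
      { state := (M q (c.tape c.pos)).2.2
        pos := c.pos + (M q (c.tape c.pos)).2.1.move
        tape := Function.update c.tape c.pos (M q (c.tape c.pos)).1 }

/-- The initial configuration: state `A`, head at cell `0`, all-blank tape. -/
def init (n k : ℕ) [NeZero k] : Cfg n k :=
  { state := if h : 0 < n then some ⟨0, h⟩ else none
    pos := 0
    tape := fun _ => 0 }

/-- `HaltsIn M c t`: started from `c`, the machine `M` halts after exactly `t` steps. -/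
def HaltsIn {n k : ℕ} (M : Machine n k) (c : Cfg n k) (t : ℕ) : Prop :=
  ((step M)^[t] c).state = none ∧ ∀ i < t, ((step M)^[i] c).state ≠ none

/-- The number of non-blank cells of a configuration. -/
noncomputable def sigmaCount {n k : ℕ} [NeZero k] (c : Cfg n k) : ℕ :=
  Set.ncard {i : ℤ | c.tape i ≠ 0}

/-- Rado's condition: every transition into the halting state writes `1` and moves right. -/
def Valid {n k : ℕ} [NeZero k] (M : Machine n k) : Prop :=
  ∀ q a, (M q a).2.2 = none → (M q a).1 = 1 ∧ (M q a).2.1 = Dir.R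

/-- The busy beaver step function `S(n,k)`: the maximum number of steps of a halting
`n`-state `k`-symbol machine started on the all-blank tape. -/
noncomputable def bbS (n k : ℕ) [NeZero k] : ℕ :=
  sSup {t : ℕ | ∃ M : Machine n k, Valid M ∧ HaltsIn M (init n k) t}

/-- The busy beaver score function `Σ(n,k)`: the maximum number of non-blank cells left
by a halting `n`-state `k`-symbol machine started on the all-blank tape. -/
noncomputable def bbSigma (n k : ℕ) [NeZero k] : ℕ :=
  sSup {m : ℕ | ∃ M : Machine n k, Valid M ∧
    ∃ t : ℕ, HaltsIn M (init n k) t ∧ sigmaCount ((step M)^[t] (init n k)) = m}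

/-- Terry and Shawn Ligocki's 3-state 3-symbol champion machine
(states `A,B,C` are `0,1,2`; `none` is the halting state `H`). -/
def M : Machine 3 3 :=
  ![![(1, Dir.R, some 1), (2, Dir.L, some 0), (1, Dir.L, some 2)],
    ![(0, Dir.L, some 0), (2, Dir.R, some 1), (1, Dir.L, some 1)],
    ![(1, Dir.R, none), (1, Dir.R, some 0), (1, Dir.R, some 2)]]

open List (replicate)

/-- The tape whose cells left of `p` are listed (nearest first) by `l` and whose cells from `p`
on are listed by `r`; all remaining cells are blank. -/
def tapeOf (p : ℤ) (l r : List (Fin 3)) : ℤ → Fin 3 := fun i =>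
  if i < p then l.getD (p - 1 - i).toNat 0 else r.getD (i - p).toNat 0

theorem tapeOf_self (p : ℤ) (l r : List (Fin 3)) : tapeOf p l r p = r.headD 0 := by
  cases r <;> simp [tapeOf]

theorem getD_tail (l : List (Fin 3)) (j : ℕ) : l.tail.getD j 0 = l.getD (j + 1) 0 := by
  cases l <;> simp

theorem update_tapeOf_right (p : ℤ) (l r : List (Fin 3)) (w : Fin 3) :
    Function.update (tapeOf p l r) p w = tapeOf (p + 1) (w :: l) r.tail := by
  funext i
  rcases lt_trichotomy i p with h | rfl | h
  · have e : (p + 1 - 1 - i).toNat = (p - 1 - i).toNat + 1 := by omega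
    simp only [tapeOf, Function.update_of_ne h.ne, if_pos h, if_pos (show i < p + 1 by omega), e,
      List.getD_cons_succ]
  · simp [tapeOf]
  · have e : (i - p).toNat = (i - (p + 1)).toNat + 1 := by omega
    simp only [tapeOf, Function.update_of_ne h.ne', if_neg (show ¬ i < p by omega),
      if_neg (show ¬ i < p + 1 by omega), e, getD_tail]

theorem update_tapeOf_left (p : ℤ) (l r : List (Fin 3)) (w : Fin 3) :
    Function.update (tapeOf p l r) p w = tapeOf (p - 1) l.tail (l.headD 0 :: w :: r.tail) := by
  funext i
  rcases lt_trichotomy i p with h | rfl | h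
  · by_cases h' : i = p - 1
    · subst h'
      cases l <;> simp [tapeOf]
    · have e : (p - 1 - i).toNat = (p - 1 - 1 - i).toNat + 1 := by omega
      simp only [tapeOf, Function.update_of_ne h.ne, if_pos h,
        if_pos (show i < p - 1 by omega), e, getD_tail]
  · have e : (i - (i - 1)).toNat = 1 := by omega
    simp [tapeOf]
  · have e : (i - (p - 1)).toNat = (i - p).toNat - 1 + 1 + 1 := by omega
    have ep : (i - p).toNat = (i - p).toNat - 1 + 1 := by omega
    simp only [tapeOf, Function.update_of_ne h.ne', if_neg (show ¬ i < p by omega),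
      if_neg (show ¬ i < p - 1 by omega), e, List.getD_cons_succ, getD_tail]
    rw [← ep]

/-- A configuration up to translation: state, cells left of the head (nearest first), and cells
from the head on. -/
abbrev Conf : Type := Option (Fin 3) × List (Fin 3) × List (Fin 3)

/-- The configuration described by `x` with the head at `p`. -/
def Conf.toCfg (p : ℤ) (x : Conf) : Cfg 3 3 := ⟨x.1, p, tapeOf p x.2.1 x.2.2⟩

theorem toCfg_append_zero (p : ℤ) (q : Option (Fin 3)) (l r : List (Fin 3)) :
    Conf.toCfg p (q, l, r ++ [0]) = Conf.toCfg p (q, l, r) := by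
  have h (j : ℕ) : (r ++ [0]).getD j 0 = r.getD j 0 := by
    rcases lt_or_ge j r.length with h | h
    · rw [List.getD_append _ _ _ _ h]
    · rw [List.getD_append_right _ _ _ _ h, List.getD_eq_default _ _ h]
      cases j - r.length <;> simp
  have e : tapeOf p l (r ++ [0]) = tapeOf p l r := by
    funext i
    simp only [tapeOf, h]
  simp only [Conf.toCfg, e]

/-- One step of the champion on a configuration up to translation. -/
def lstep : Conf → Conf
  | (none, l, r) => (none, l, r)
  | (some q, l, r) =>
    match M q (r.headD 0) with
    | (w, Dir.R, q') => (q', w :: l, r.tail)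
    | (w, Dir.L, q') => (q', l.tail, l.headD 0 :: w :: r.tail)

theorem exists_step_toCfg (p : ℤ) (x : Conf) :
    ∃ p', step M (x.toCfg p) = (lstep x).toCfg p' := by
  obtain ⟨_ | q, l, r⟩ := x
  · exact ⟨p, rfl⟩
  · rcases h : M q (r.headD 0) with ⟨w, _ | _, q'⟩
    · exact ⟨p - 1, by
        simp only [step, Conf.toCfg, lstep, tapeOf_self, h, update_tapeOf_left, Dir.move,
          sub_eq_add_neg]⟩
    · exact ⟨p + 1, by
        simp only [step, Conf.toCfg, lstep, tapeOf_self, h, update_tapeOf_right, Dir.move]⟩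

/-- The champion goes from `x` to `y`, up to translation, in `t` steps. -/
def Reaches (t : ℕ) (x y : Conf) : Prop :=
  ∀ p, ∃ p', (step M)^[t] (x.toCfg p) = y.toCfg p'

namespace Reaches

variable {s t u : ℕ} {x y z : Conf}

theorem refl (x : Conf) : Reaches 0 x x := fun p => ⟨p, rfl⟩

theorem trans (h₁ : Reaches s x y) (h₂ : Reaches t y z) (h : u = s + t := by ring) :
    Reaches u x z := by
  intro p
  obtain ⟨p₁, e₁⟩ := h₁ p
  obtain ⟨p₂, e₂⟩ := h₂ p₁
  exact ⟨p₂, by rw [h, add_comm, Function.iterate_add_apply, e₁, e₂]⟩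

theorem of_lstep (t : ℕ) (h : lstep^[t] x = y) : Reaches t x y := by
  induction t generalizing x with
  | zero => exact h ▸ refl x
  | succ t ih =>
    have h1 : Reaches 1 x (lstep x) := fun p => exists_step_toCfg p x
    exact h1.trans (ih h)

theorem drop_zero {q : Option (Fin 3)} {l r : List (Fin 3)} (h : Reaches t x (q, l, r ++ [0])) :
    Reaches t x (q, l, r) := by
  intro p
  obtain ⟨p', e⟩ := h p
  exact ⟨p', by rw [e, toCfg_append_zero]⟩

end Reaches

theorem replicate_append_cons_self (k : ℕ) (a : Fin 3) (l : List (Fin 3)) :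
    replicate k a ++ a :: l = replicate (k + 1) a ++ l := by
  rw [List.replicate_succ', List.append_assoc]
  rfl

/-- In state `B` the head runs right over a block of `1`s, turning them into `2`s. -/
theorem reaches_B_right (k : ℕ) (l r : List (Fin 3)) :
    Reaches k (some 1, l, replicate k 1 ++ r) (some 1, replicate k 2 ++ l, r) := by
  induction k generalizing l with
  | zero => exact Reaches.refl _
  | succ k ih =>
    have h : Reaches 1 (some 1, l, replicate (k + 1) 1 ++ r)
        (some 1, 2 :: l, replicate k 1 ++ r) := Reaches.of_lstep 1 rfl
    rw [← replicate_append_cons_self k 2 l]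
    exact h.trans (ih _)

/-- In state `B` the head runs left over a block of `2`s, turning them into `1`s. -/
theorem reaches_B_left (k : ℕ) (l r : List (Fin 3)) :
    Reaches (k + 1) (some 1, replicate k 2 ++ l, 2 :: r)
      (some 1, l.tail, l.headD 0 :: (replicate (k + 1) 1 ++ r)) := by
  induction k generalizing r with
  | zero => exact Reaches.of_lstep 1 rfl
  | succ k ih =>
    have h : Reaches 1 (some 1, replicate (k + 1) 2 ++ l, 2 :: r)
        (some 1, replicate k 2 ++ l, 2 :: 1 :: r) := Reaches.of_lstep 1 rfl
    rw [← replicate_append_cons_self (k + 1) 1 r]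
    exact h.trans (ih _)

/-- In state `A` the head runs left over a block of `1`s, turning them into `2`s. -/
theorem reaches_A_left (k : ℕ) (l r : List (Fin 3)) :
    Reaches (k + 1) (some 0, replicate k 1 ++ l, 1 :: r)
      (some 0, l.tail, l.headD 0 :: (replicate (k + 1) 2 ++ r)) := by
  induction k generalizing r with
  | zero => exact Reaches.of_lstep 1 rfl
  | succ k ih =>
    have h : Reaches 1 (some 0, replicate (k + 1) 1 ++ l, 1 :: r)
        (some 0, replicate k 1 ++ l, 1 :: 2 :: r) := Reaches.of_lstep 1 rfl
    rw [← replicate_append_cons_self (k + 1) 2 r]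
    exact h.trans (ih _)

/-- Tape `1^a 2^c [2^b]`, state `B`. -/
def bounceConf (a c b : ℕ) : Conf := (some 1, replicate c 2 ++ replicate a 1, replicate b 2)

/-- Tape `[0] 0 1^a 2^b`, state `A`. -/
def growConf (a b : ℕ) : Conf := (some 0, [], 0 :: 0 :: (replicate a 1 ++ replicate b 2))

/-- Tape `[0] 2^n`, state `A`. -/
def blockConf (n : ℕ) : Conf := (some 0, [], 0 :: replicate n 2)

/-- Tape `1^a 2^d [2^m]`, state `A`. -/
def eatConf (a d m : ℕ) : Conf := (some 0, replicate d 2 ++ replicate a 1, replicate m 2)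

theorem reaches_bounce_succ (a c b : ℕ) :
    Reaches (2 * c + 3) (bounceConf (a + 1) c (b + 1)) (bounceConf a (c + 2) b) := by
  have h₁ := reaches_B_left c (replicate (a + 1) 1) (replicate b 2)
  have h₂ := reaches_B_right (c + 2) (replicate a 1) (replicate b 2)
  exact h₁.trans h₂

theorem reaches_bounce (b a c m : ℕ) :
    Reaches (2 * b * c + b + 2 * b ^ 2) (bounceConf (a + b) c (m + b))
      (bounceConf a (c + 2 * b) m) := by
  induction b generalizing c with
  | zero => simpa using Reaches.refl (bounceConf a c m)
  | succ b ih =>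
    have h := ih (c + 2)
    rw [show c + 2 + 2 * b = c + 2 * (b + 1) by ring] at h
    exact (reaches_bounce_succ (a + b) c (m + b)).trans h

theorem reaches_grow_of_bounce (c b : ℕ) :
    Reaches (c + 2) (bounceConf 0 c (b + 1)) (growConf (c + 1) b) := by
  have h₁ := reaches_B_left c [] (replicate b 2)
  have h₂ : Reaches 1 (some 1, [], 0 :: (replicate (c + 1) 1 ++ replicate b 2))
      (growConf (c + 1) b) := Reaches.of_lstep 1 rfl
  have e : bounceConf 0 c (b + 1) = (some 1, replicate c 2 ++ [], 2 :: replicate b 2) := rfl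
  rw [e]
  exact h₁.trans h₂

theorem reaches_bounce_of_grow (a b : ℕ) :
    Reaches (a + 12) (growConf a b) (bounceConf 3 a b) := by
  have h₁ : Reaches 12 (growConf a b)
      (some 1, [1, 1, 1], replicate a 1 ++ replicate b 2) := Reaches.of_lstep 12 rfl
  exact h₁.trans (reaches_B_right a [1, 1, 1] (replicate b 2))

theorem reaches_grow_succ (a b : ℕ) :
    Reaches (8 * a + 41) (growConf a (b + 4)) (growConf (a + 7) b) := by
  have h₁ := reaches_bounce_of_grow a (b + 4)
  have h₂ := reaches_bounce 3 0 a (b + 1)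
  exact (h₁.trans h₂ rfl).trans (reaches_grow_of_bounce _ _)

theorem reaches_grow (k a b : ℕ) :
    Reaches (8 * a * k + 28 * k ^ 2 + 13 * k) (growConf a (b + 4 * k))
      (growConf (a + 7 * k) b) := by
  induction k generalizing a with
  | zero => exact Reaches.refl _
  | succ k ih =>
    have h := ih (a + 7)
    rw [show a + 7 + 7 * k = a + 7 * (k + 1) by ring] at h
    exact (reaches_grow_succ a (b + 4 * k)).trans h

theorem reaches_grow_of_block (n : ℕ) : Reaches 8 (blockConf (n + 2)) (growConf 3 n) :=
  Reaches.of_lstep 8 rfl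

theorem reaches_bounce_of_block (k a b : ℕ) (hab : a + b = 3) :
    Reaches (28 * k ^ 2 + 44 * k + 23 + b * (14 * k + 7) + 2 * b ^ 2) (blockConf (4 * k + 2 + b))
      (bounceConf a (7 * k + 3 + 2 * b) 0) := by
  have h₁ := reaches_grow_of_block (b + 4 * k)
  have h₂ := reaches_grow k 3 b
  have h₃ := reaches_bounce_of_grow (3 + 7 * k) b
  have h₄ := reaches_bounce b a (3 + 7 * k) 0
  rw [hab, zero_add, show 3 + 7 * k + 2 * b = 7 * k + 3 + 2 * b by ring] at h₄
  rw [show 4 * k + 2 + b = b + 4 * k + 2 by ring]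
  exact ((h₁.trans h₂ rfl).trans h₃ rfl).trans h₄

theorem reaches_eat_of_bounce (a c : ℕ) :
    Reaches 9 (bounceConf a (c + 3) 0) (eatConf a c 4) :=
  Reaches.drop_zero (Reaches.of_lstep 9 rfl)

theorem reaches_eat (e a d m : ℕ) :
    Reaches (8 * e) (eatConf a (d + 2 * e) (m + 2)) (eatConf a d (m + 2 + 2 * e)) := by
  induction e generalizing m with
  | zero => exact Reaches.refl _
  | succ e ih =>
    have h₁ : Reaches 8 (eatConf a (d + 2 * e + 2) (m + 2)) (eatConf a (d + 2 * e) (m + 2 + 2)) :=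
      Reaches.of_lstep 8 rfl
    have h₂ := ih (m + 2)
    rw [show m + 2 + 2 + 2 * e = m + 2 + 2 * (e + 1) by ring] at h₂
    exact h₁.trans h₂

theorem replicate_append_replicate (a b : ℕ) (x : Fin 3) :
    replicate a x ++ replicate b x = replicate (a + b) x :=
  List.replicate_append_replicate

theorem reaches_block_of_eat_zero (a m : ℕ) :
    Reaches (a + 4) (eatConf (a + 1) 0 (m + 1)) (blockConf (a + m + 2)) := by
  have h₁ : Reaches 2 (eatConf (a + 1) 0 (m + 1))
      (some 0, replicate (a + 1) 1 ++ [], 1 :: replicate m 2) :=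
    Reaches.of_lstep 2 (by rw [List.append_nil]; rfl)
  have h₂ := reaches_A_left (a + 1) [] (replicate m 2)
  rw [replicate_append_replicate, show a + 1 + 1 + m = a + m + 2 by ring] at h₂
  exact h₁.trans h₂

theorem reaches_block_of_eat_one (a m : ℕ) :
    Reaches (a + 8) (eatConf a 1 (m + 2)) (blockConf (a + m + 3)) := by
  have h₁ : Reaches 5 (eatConf a 1 (m + 2))
      (some 0, replicate (a + 2) 1 ++ [], 1 :: replicate m 2) :=
    Reaches.of_lstep 5 (by rw [List.append_nil]; rfl)
  have h₂ := reaches_A_left (a + 2) [] (replicate m 2)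
  rw [replicate_append_replicate, show a + 2 + 1 + m = a + m + 3 by ring] at h₂
  exact h₁.trans h₂

theorem reaches_block_of_bounce (a c : ℕ) (hc : 3 ≤ c) (h : a = 0 → c % 2 = 0) :
    Reaches (4 * c + a + (1 - c % 2)) (bounceConf a c 0) (blockConf (a + c + 1)) := by
  rcases Nat.mod_two_eq_zero_or_one c with h0 | h1
  · obtain ⟨e, rfl⟩ : ∃ e, c = 1 + 2 * e + 3 := ⟨(c - 4) / 2, by omega⟩
    have h₁ := reaches_eat_of_bounce a (1 + 2 * e)
    have h₂ := reaches_eat e a 1 2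
    have h₃ := reaches_block_of_eat_one a (2 + 2 * e)
    rw [show 2 + 2 * e + 2 = 2 + 2 + 2 * e by ring] at h₃
    convert (h₁.trans h₂ rfl).trans h₃ rfl using 1
    · omega
    · congr 1; ring
  · obtain ⟨e, rfl⟩ : ∃ e, c = 0 + 2 * e + 3 := ⟨(c - 3) / 2, by omega⟩
    obtain ⟨a, rfl⟩ : ∃ a', a = a' + 1 := ⟨a - 1, by omega⟩
    have h₁ := reaches_eat_of_bounce (a + 1) (0 + 2 * e)
    have h₂ := reaches_eat e (a + 1) 0 2
    have h₃ := reaches_block_of_eat_zero a (3 + 2 * e)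
    rw [show 3 + 2 * e + 1 = 2 + 2 + 2 * e by ring] at h₃
    convert (h₁.trans h₂ rfl).trans h₃ rfl using 1
    · omega
    · congr 1; ring

/-- The block length following `n` when the champion does not halt. -/
def nextBlock (n : ℕ) : ℕ := 7 * ((n - 2) / 4) + 7 + (n - 2) % 4

/-- The number of steps from the block of length `n` to the moment the head first stands right
of the resulting pattern `1^a 2^c`. -/
def bounceTime (n : ℕ) : ℕ :=
  let k := (n - 2) / 4
  let b := (n - 2) % 4
  28 * k ^ 2 + 44 * k + 23 + b * (14 * k + 7) + 2 * b ^ 2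

/-- The number of steps from the block of length `n` to the next one. -/
def blockTime (n : ℕ) : ℕ :=
  let k := (n - 2) / 4
  let b := (n - 2) % 4
  bounceTime n + (4 * (7 * k + 3 + 2 * b) + (3 - b) + (1 - (7 * k + 3 + 2 * b) % 2))

theorem reaches_nextBlock (n : ℕ) (hn : 2 ≤ n) (h5 : n % 8 ≠ 5) :
    Reaches (blockTime n) (blockConf n) (blockConf (nextBlock n)) := by
  have hk : n = 4 * ((n - 2) / 4) + 2 + (n - 2) % 4 := by omega
  have hb : (n - 2) % 4 < 4 := Nat.mod_lt _ (by norm_num)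
  unfold blockTime bounceTime nextBlock
  generalize (n - 2) / 4 = k at *
  generalize (n - 2) % 4 = b at *
  have h₁ := reaches_bounce_of_block k (3 - b) b (by omega)
  have h₂ := reaches_block_of_bounce (3 - b) (7 * k + 3 + 2 * b) (by omega) (by omega)
  rw [← hk] at h₁
  rw [show 3 - b + (7 * k + 3 + 2 * b) + 1 = 7 * k + 7 + b by omega] at h₂
  exact h₁.trans h₂ rfl

/-- The block of length `8 * j + 5` leads to the transition into the halting state. -/
theorem reaches_halt_of_block (j : ℕ) :
    Reaches (bounceTime (8 * j + 5) + (56 * j + 34)) (blockConf (8 * j + 5))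
      (some 2, [], 0 :: 1 :: replicate (14 * j + 9) 2) := by
  have h₁ := reaches_bounce_of_block (2 * j) 0 3 rfl
  have h₂ := reaches_eat_of_bounce 0 (14 * j + 6)
  have h₃ := reaches_eat (7 * j + 3) 0 0 2
  have h₄ : Reaches 1 (eatConf 0 0 (14 * j + 9 + 1))
      (some 2, [], 0 :: 1 :: replicate (14 * j + 9) 2) := Reaches.of_lstep 1 rfl
  rw [show 7 * (2 * j) + 3 + 2 * 3 = 14 * j + 6 + 3 by ring,
    show 4 * (2 * j) + 2 + 3 = 8 * j + 5 by ring] at h₁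
  rw [show 0 + 2 * (7 * j + 3) = 14 * j + 6 by ring,
    show 2 + 2 + 2 * (7 * j + 3) = 14 * j + 9 + 1 by ring] at h₃
  have e₁ : (8 * j + 5 - 2) / 4 = 2 * j := by omega
  have e₂ : (8 * j + 5 - 2) % 4 = 3 := by omega
  refine ((h₁.trans h₂ rfl).trans h₃ rfl).trans h₄ ?_
  simp only [bounceTime, e₁, e₂]
  ring

/-- A chain of block lengths linked by `nextBlock` is followed by the champion. -/
theorem reaches_of_isChain (ns : List ℕ) (n : ℕ)
    (h : (n :: ns).IsChain fun a b => 2 ≤ a ∧ a % 8 ≠ 5 ∧ nextBlock a = b) :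
    Reaches ((n :: ns).dropLast.map blockTime).sum (blockConf n)
      (blockConf ((n :: ns).getLast (List.cons_ne_nil n ns))) := by
  induction ns generalizing n with
  | nil => exact Reaches.refl _
  | cons m ns ih =>
    obtain ⟨⟨h2, h5, rfl⟩, h⟩ := List.isChain_cons_cons.1 h
    exact (reaches_nextBlock n h2 h5).trans (ih _ h) rfl

theorem init_eq_toCfg : init 3 3 = Conf.toCfg 0 (some 0, [], []) := by
  have e : tapeOf 0 [] [] = fun _ => 0 := by
    funext i
    simp [tapeOf]
  simp [init, Conf.toCfg, e]

theorem ncard_tapeOf_halt (p : ℤ) (m : ℕ) :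
    {i : ℤ | tapeOf p [1] (1 :: replicate m 2) i ≠ 0}.ncard = m + 2 := by
  have h : {i : ℤ | tapeOf p [1] (1 :: replicate m 2) i ≠ 0} = Set.Icc (p - 1) (p + m) := by
    ext i
    simp only [Set.mem_ofPred_eq, Set.mem_Icc, tapeOf]
    rcases lt_or_ge i p with hi | hi
    · rw [if_pos hi]
      rcases hj : (p - 1 - i).toNat with _ | j
      · simp; omega
      · simp; omega
    · rw [if_neg (by omega)]
      rcases hj : (i - p).toNat with _ | j
      · simp; omega
      · rw [List.getD_cons_succ]
        rcases lt_or_ge j m with hm | hm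
        · rw [List.getD_replicate (2 : Fin 3) hm]
          simp; omega
        · rw [List.getD_eq_default _ _ (by simpa using hm)]
          simp; omega
  rw [h, Set.ncard_eq_toFinset_card']
  simp
  omega

theorem iterate_step_of_state_eq_none {n k : ℕ} (M : Machine n k) (c : Cfg n k)
    (h : c.state = none) (t : ℕ) : (step M)^[t] c = c := by
  have h1 : step M c = c := by simp [step, h]
  exact Function.iterate_fixed h1 t

theorem haltsIn_succ {n k : ℕ} {M : Machine n k} {c : Cfg n k} {t : ℕ}
    (h : ((step M)^[t] c).state ≠ none) (h' : ((step M)^[t + 1] c).state = none) :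
    HaltsIn M c (t + 1) := by
  refine ⟨h', fun i hi hn => h ?_⟩
  obtain ⟨d, rfl⟩ := Nat.exists_eq_add_of_le' (Nat.lt_succ_iff.1 hi)
  rw [Function.iterate_add_apply, iterate_step_of_state_eq_none M _ hn, hn]

theorem HaltsIn.unique {n k : ℕ} {M : Machine n k} {c : Cfg n k} {s t : ℕ}
    (hs : HaltsIn M c s) (ht : HaltsIn M c t) : s = t := by
  rcases lt_trichotomy s t with h | h | h
  · exact absurd hs.1 (ht.2 s h)
  · exact h
  · exact absurd ht.1 (hs.2 t h)

instance : Finite Dir :=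
  Finite.of_surjective (fun b : Bool => if b then Dir.L else Dir.R)
    (by rintro (_ | _); exacts [⟨true, rfl⟩, ⟨false, rfl⟩])

theorem bddAbove_of_haltsIn {n k : ℕ} [NeZero k] (f : Machine n k → ℕ → ℕ) :
    BddAbove {m : ℕ | ∃ M : Machine n k, Valid M ∧ ∃ t, HaltsIn M (init n k) t ∧ f M t = m} := by
  refine Set.Finite.bddAbove ((Set.finite_iUnion (f := fun M : Machine n k =>
    {m : ℕ | ∃ t, HaltsIn M (init n k) t ∧ f M t = m}) fun M => ?_).subset ?_)
  · refine Set.Subsingleton.finite ?_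
    rintro _ ⟨s, hs, rfl⟩ _ ⟨t, ht, rfl⟩
    rw [hs.unique ht]
  · rintro m ⟨M, -, h⟩
    exact Set.mem_iUnion.2 ⟨M, h⟩

theorem HaltsIn.le_bbS {n k : ℕ} [NeZero k] {M : Machine n k} (hM : Valid M) {t : ℕ}
    (h : HaltsIn M (init n k) t) : t ≤ bbS n k := by
  refine le_csSup ((bddAbove_of_haltsIn (n := n) (k := k) fun _ t => t).mono ?_) ⟨M, hM, h⟩
  rintro t ⟨M, hM, h⟩
  exact ⟨M, hM, t, h, rfl⟩

theorem HaltsIn.sigmaCount_le_bbSigma {n k : ℕ} [NeZero k] {M : Machine n k} (hM : Valid M)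
    {t : ℕ} (h : HaltsIn M (init n k) t) :
    sigmaCount ((step M)^[t] (init n k)) ≤ bbSigma n k :=
  le_csSup (bddAbove_of_haltsIn fun M t => sigmaCount ((step M)^[t] (init n k)))
    ⟨M, hM, t, h, rfl⟩

theorem valid_M : Valid M := by
  intro q a
  fin_cases q <;> fin_cases a <;> simp [M]

theorem haltsIn_of_reaches {t m : ℕ}
    (h : Reaches t (some 0, [], []) (some 2, [], 0 :: 1 :: replicate m 2)) :
    HaltsIn M (init 3 3) (t + 1) ∧ sigmaCount ((step M)^[t + 1] (init 3 3)) = m + 2 := by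
  obtain ⟨p, hp⟩ := h 0
  rw [← init_eq_toCfg] at hp
  obtain ⟨p', hp'⟩ := exists_step_toCfg p (some 2, [], 0 :: 1 :: replicate m 2)
  rw [← hp, ← Function.iterate_succ_apply' (step M)] at hp'
  refine ⟨haltsIn_succ ?_ ?_, ?_⟩
  · rw [hp]
    exact Option.some_ne_none _
  · rw [hp']
    rfl
  · rw [hp']
    exact ncard_tapeOf_halt p' m

theorem reaches_last_block :
    Reaches (119112334170342539 - (bounceTime 214100789 + (56 * 26762598 + 34)))
      (some 0, [], []) (blockConf 214100789) := by
  have h₁ : Reaches 16 (some 0, [], []) (blockConf 3) :=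
    Reaches.drop_zero (Reaches.of_lstep 16 rfl)
  have h₂ := reaches_of_isChain [8, 16, 30, 56, 100, 177, 311, 547, 960, 1682, 2947, 5160, 9032,
    15808, 27666, 48419, 84736, 148290, 259511, 454147, 794760, 1390832, 2433958, 4259430,
    7454006, 13044514, 22827903, 39948833, 69910459, 122343306, 214100789] 3 (by decide)
  exact h₁.trans h₂ (by decide)

/-- Started on the all-blank tape, the Ligockis' champion halts after exactly
119,112,334,170,342,540 steps leaving exactly 374,676,383 non-blank cells; hence
`S(3,3) ≥ 119,112,334,170,342,540` and `Σ(3,3) ≥ 374,676,383`. -/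
theorem ligocki_33_champion :
    HaltsIn M (init 3 3) 119112334170342540 ∧
    sigmaCount ((step M)^[119112334170342540] (init 3 3)) = 374676383 ∧
    119112334170342540 ≤ bbS 3 3 ∧ 374676383 ≤ bbSigma 3 3 := by
  have h₁ := reaches_last_block.trans (reaches_halt_of_block 26762598)
    (u := 119112334170342539) (by decide)
  obtain ⟨h, hσ⟩ := haltsIn_of_reaches h₁
  exact ⟨h, hσ, h.le_bbS valid_M, hσ.symm.le.trans (h.sigmaCount_le_bbSigma valid_M)⟩
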